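/- Let β > 0, C > 0 and d ∈ ℕ. There exists a constant c > 0, depending only on d, β and C, with the following property: for every finite set Ξ ⊆ [0,1]^d with at least two points, and every pair of Borel probability measures P, Q supported on Ξ, one has ‖P − Q‖_{H^β(ℝ^d,ℝ,C)} ≥ c · (sep(Ξ))^β · ‖P − Q‖_TV, where sep(Ξ) = min_{ξ ≠ ξ′ ∈ Ξ} ‖ξ − ξ′‖_∞ and ‖P − Q‖_TV = sup_{A Borel} |P(A) − Q(A)| is the total variation distance. -/

import Mathlib

open Filter Topology MeasureTheory Set
open scoped ENNReal NNReal

noncomputable section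

/-- Minimal number of closed balls of radius `ε` needed to cover `S`. -/
def coverN {X : Type*} [PseudoMetricSpace X] (ε : ℝ) (S : Set X) : ℕ∞ :=
  ⨅ (t : Finset X) (_ : S ⊆ ⋃ x ∈ t, Metric.closedBall x ε), (t.card : ℕ∞)

/-- The `(ε,τ)`-covering number of a measure `μ`. -/
def measCoverN {X : Type*} [PseudoMetricSpace X] [MeasurableSpace X]
    (μ : Measure X) (ε τ : ℝ) : ℕ∞ :=
  ⨅ (S : Set X) (_ : MeasurableSet S) (_ : ENNReal.ofReal (1 - τ) ≤ μ S), coverN ε S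

/-- Extended logarithm `ℝ≥0∞ → EReal`. -/
def elog (x : ℝ≥0∞) : EReal :=
  if x = 0 then ⊥ else if x = ⊤ then ⊤ else ((Real.log x.toReal : ℝ) : EReal)

/-- `log N / log (1/ε)` as an extended real. -/
def dimRatio (N : ℕ∞) (ε : ℝ) : EReal :=
  elog (N : ℝ≥0∞) * (((Real.log (1 / ε))⁻¹ : ℝ) : EReal)

/-- The `α`-entropic dimension of a measure. -/
def entropicDim {X : Type*} [PseudoMetricSpace X] [MeasurableSpace X]
    (μ : Measure X) (α : ℝ) : EReal :=
  limsup (fun ε : ℝ => dimRatio (measCoverN μ ε (ε ^ α)) ε) (𝓝[>] (0 : ℝ))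

/-- The `α`-upper Wasserstein dimension of a measure. -/
def upperWDim {X : Type*} [PseudoMetricSpace X] [MeasurableSpace X]
    (μ : Measure X) (α : ℝ) : EReal :=
  sInf {x : EReal | ∃ s : ℝ, x = (s : EReal) ∧ 2 * α < s ∧
    limsup (fun ε : ℝ => dimRatio (measCoverN μ ε (ε ^ (s * α / (s - 2 * α)))) ε)
      (𝓝[>] (0 : ℝ)) ≤ (s : EReal)}

/-- The lower Wasserstein dimension of a measure. -/
def lowerWDim {X : Type*} [PseudoMetricSpace X] [MeasurableSpace X]
    (μ : Measure X) : EReal :=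
  limsup (fun τ : ℝ =>
    liminf (fun ε : ℝ => dimRatio (measCoverN μ ε τ) ε) (𝓝[>] (0 : ℝ))) (𝓝[>] (0 : ℝ))

/-- The support of a measure: points all of whose neighbourhoods have positive mass. -/
def msupport {X : Type*} [PseudoMetricSpace X] [MeasurableSpace X] (μ : Measure X) : Set X :=
  {x | ∀ r : ℝ, 0 < r → 0 < μ (Metric.ball x r)}

/-- The upper Minkowski dimension of (the support of) a measure. -/
def minkowskiDim {X : Type*} [PseudoMetricSpace X] [MeasurableSpace X]
    (μ : Measure X) : EReal :=
  limsup (fun ε : ℝ => dimRatio (coverN ε (msupport μ)) ε) (𝓝[>] (0 : ℝ))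

/-- The upper packing dimension of a measure. -/
def packingDim {X : Type*} [PseudoMetricSpace X] [MeasurableSpace X]
    (μ : Measure X) : EReal :=
  essSup (fun x =>
    limsup (fun r : ℝ => elog (μ (Metric.closedBall x r)) * (((Real.log r)⁻¹ : ℝ) : EReal))
      (𝓝[>] (0 : ℝ))) μ

/-- The lower regularity dimension of a measure. -/
def lowerRegDim {X : Type*} [PseudoMetricSpace X] [MeasurableSpace X]
    (μ : Measure X) : EReal :=
  sSup {x : EReal | ∃ s : ℝ, x = (s : EReal) ∧ ∃ C : ℝ, 0 < C ∧
    ∀ x0 ∈ msupport μ, ∀ r R : ℝ, 0 < r → r < R →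
      ENNReal.ofReal (C * (R / r) ^ s) ≤
        μ (Metric.closedBall x0 R) / μ (Metric.closedBall x0 r)}

/-- Partial derivative in coordinate `i`. -/
def pderiv' {d : ℕ} (i : Fin d) (f : (Fin d → ℝ) → ℝ) : (Fin d → ℝ) → ℝ :=
  fun x => fderiv ℝ f x (Pi.single i 1)

/-- Multi-index partial derivative `∂^s f`. -/
def mpderiv {d : ℕ} (s : Fin d → ℕ) (f : (Fin d → ℝ) → ℝ) : (Fin d → ℝ) → ℝ :=
  (List.finRange d).foldr (fun i g => (pderiv' i)^[s i] g) f

/-- The `β`-Hölder norm of `f : ℝ^d → ℝ` (with `ℓ∞` distances), valued in `ℝ≥0∞`. -/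
def holderNorm {d : ℕ} (β : ℝ) (f : (Fin d → ℝ) → ℝ) : ℝ≥0∞ :=
  (∑' s : {s : Fin d → ℕ // ∑ i, s i ≤ ⌊β⌋₊}, ⨆ x : Fin d → ℝ, (‖mpderiv s.1 f x‖₊ : ℝ≥0∞)) +
  ∑' s : {s : Fin d → ℕ // ∑ i, s i = ⌊β⌋₊}, ⨆ (x : Fin d → ℝ) (y : Fin d → ℝ) (_ : x ≠ y),
      (‖mpderiv s.1 f x - mpderiv s.1 f y‖₊ : ℝ≥0∞) / (nndist x y : ℝ≥0∞) ^ (β - (⌊β⌋₊ : ℝ))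

/-- The class `H^β(ℝ^d, ℝ, C)` of `β`-Hölder functions with norm at most `C`. -/
def HolderClass (d : ℕ) (β C : ℝ) : Set ((Fin d → ℝ) → ℝ) :=
  {f | ContDiff ℝ (⌊β⌋₊ : ℕ) f ∧ holderNorm β f ≤ ENNReal.ofReal C}

/-- The integral probability metric `‖P - Q‖_F`. -/
def ipm {X : Type*} [MeasurableSpace X] (F : Set (X → ℝ)) (P Q : Measure X) : ℝ :=
  ⨆ f : F, |∫ x, f.1 x ∂P - ∫ x, f.1 x ∂Q|

/-- The empirical measure of a sample `x : Fin n → X`. -/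
def empMeas {X : Type*} [MeasurableSpace X] {n : ℕ} (x : Fin n → X) : Measure X :=
  (n : ℝ≥0∞)⁻¹ • ∑ i : Fin n, Measure.dirac (x i)

/-- Total variation distance between two measures. -/
def tvDist {X : Type*} [MeasurableSpace X] (P Q : Measure X) : ℝ :=
  ⨆ A : {A : Set X // MeasurableSet A}, |(P A.1).toReal - (Q A.1).toReal|

end

open Filter Topology MeasureTheory Set
open scoped ENNReal

/-- The minimal `ℓ∞`-separation of a finite set of points. -/
noncomputable def finsep {d : ℕ} (Ξ : Finset (Fin d → ℝ)) : ℝ :=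
  ⨅ p : {p : (Fin d → ℝ) × (Fin d → ℝ) // p.1 ∈ Ξ ∧ p.2 ∈ Ξ ∧ p.1 ≠ p.2}, dist p.1.1 p.1.2

/-! ### Superpositions of rescaled translates -/

/-- The superposition `x ↦ ∑ ξ ∈ S, a * g (c • (x - ξ))` of rescaled translates of `g`. -/
def translateSum {d : ℕ} (S : Finset (Fin d → ℝ)) (c a : ℝ) (g : (Fin d → ℝ) → ℝ) :
    (Fin d → ℝ) → ℝ :=
  fun x => ∑ ξ ∈ S, a * g (c • (x - ξ))

/-- Smooth functions supported in the closed ball of radius `1/4` around the origin. -/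
def IsSmoothBump {d : ℕ} (g : (Fin d → ℝ) → ℝ) : Prop :=
  ContDiff ℝ (⊤ : ℕ∞) g ∧ tsupport g ⊆ Metric.closedBall 0 (1 / 4)

theorem IsSmoothBump.pderiv' {d : ℕ} {g : (Fin d → ℝ) → ℝ} (hg : IsSmoothBump g) (i : Fin d) :
    IsSmoothBump (pderiv' i g) := by
  refine ⟨(hg.1.fderiv_right (m := (⊤ : ℕ∞)) (by simp)).clm_apply contDiff_const, ?_⟩
  refine (closure_minimal (fun x hx => ?_) (isClosed_tsupport g)).trans hg.2
  refine support_fderiv_subset ℝ (f := g) fun h => hx ?_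
  simp [_root_.pderiv', h]

theorem IsSmoothBump.iterate_pderiv' {d : ℕ} {g : (Fin d → ℝ) → ℝ} (hg : IsSmoothBump g)
    (i : Fin d) (n : ℕ) : IsSmoothBump ((_root_.pderiv' i)^[n] g) := by
  induction n with
  | zero => exact hg
  | succ n ih => rw [Function.iterate_succ_apply']; exact ih.pderiv' i

theorem IsSmoothBump.foldr_pderiv' {d : ℕ} {g : (Fin d → ℝ) → ℝ} (hg : IsSmoothBump g)
    (s : Fin d → ℕ) (l : List (Fin d)) :
    IsSmoothBump (l.foldr (fun i g => (_root_.pderiv' i)^[s i] g) g) := by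
  induction l with
  | nil => exact hg
  | cons i l ih => exact ih.iterate_pderiv' i (s i)

theorem IsSmoothBump.mpderiv {d : ℕ} {g : (Fin d → ℝ) → ℝ} (hg : IsSmoothBump g)
    (s : Fin d → ℕ) : IsSmoothBump (mpderiv s g) :=
  hg.foldr_pderiv' s _

theorem IsSmoothBump.eq_zero {d : ℕ} {g : (Fin d → ℝ) → ℝ} (hg : IsSmoothBump g)
    {x : Fin d → ℝ} (hx : 1 / 2 ≤ ‖x‖) : g x = 0 := by
  refine image_eq_zero_of_notMem_tsupport fun h => ?_
  have := hg.2 h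
  rw [mem_closedBall_zero_iff] at this
  linarith

theorem IsSmoothBump.exists_bound {d : ℕ} {g : (Fin d → ℝ) → ℝ} (hg : IsSmoothBump g) :
    ∃ K : ℝ, (∀ x, |g x| ≤ K) ∧ ∀ x y, |g x - g y| ≤ K * dist x y := by
  have hc : HasCompactSupport g :=
    (isCompact_closedBall (0 : Fin d → ℝ) (1 / 4)).of_isClosed_subset (isClosed_tsupport g) hg.2
  obtain ⟨M, hM⟩ := hg.1.continuous.bounded_above_of_compact_support hc
  obtain ⟨L, hL⟩ := hg.1.lipschitzWith_of_hasCompactSupport hc (by simp)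
  refine ⟨max M L, fun x => (hM x).trans (le_max_left _ _), fun x y => ?_⟩
  have := hL.dist_le_mul x y
  rw [Real.dist_eq] at this
  exact this.trans (mul_le_mul_of_nonneg_right (le_max_right _ _) dist_nonneg)

/-- A bounded Lipschitz function is Hölder of every order `γ ∈ [0, 1]`. -/
theorem abs_sub_le_rpow_dist {X : Type*} [PseudoMetricSpace X] {g : X → ℝ} {K γ : ℝ}
    (hb : ∀ x, |g x| ≤ K) (hl : ∀ x y, |g x - g y| ≤ K * dist x y)
    (h0 : 0 ≤ γ) (h1 : γ ≤ 1) (x y : X) : |g x - g y| ≤ 2 * K * dist x y ^ γ := by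
  have hK : 0 ≤ K := (abs_nonneg _).trans (hb x)
  rcases le_total (dist x y) 1 with h | h
  · have h2 : dist x y ≤ dist x y ^ γ := Real.self_le_rpow_of_le_one dist_nonneg h h1
    have h3 : 0 ≤ dist x y ^ γ := by positivity
    nlinarith [hl x y, mul_le_mul_of_nonneg_left h2 hK, mul_nonneg hK h3]
  · have h2 : 1 ≤ dist x y ^ γ := Real.one_le_rpow h h0
    have h3 := abs_sub (g x) (g y)
    nlinarith [hb x, hb y, mul_le_mul_of_nonneg_left h2 hK]

theorem pderiv'_translateSum {d : ℕ} (S : Finset (Fin d → ℝ)) (c a : ℝ)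
    {g : (Fin d → ℝ) → ℝ} (hg : Differentiable ℝ g) (i : Fin d) :
    pderiv' i (translateSum S c a g) = translateSum S c (a * c) (pderiv' i g) := by
  funext x
  have h : HasFDerivAt (translateSum S c a g)
      (∑ ξ ∈ S, a • (fderiv ℝ g (c • (x - ξ))).comp
        (c • ContinuousLinearMap.id ℝ (Fin d → ℝ))) x := by
    unfold translateSum
    refine HasFDerivAt.fun_sum fun ξ _ => HasFDerivAt.const_mul ?_ a
    exact (hg _).hasFDerivAt.comp x (((hasFDerivAt_id x).sub_const ξ).const_smul c)
  simp only [pderiv', h.fderiv, translateSum, sum_apply]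
  refine Finset.sum_congr rfl fun ξ _ => ?_
  simp [mul_assoc]

theorem iterate_pderiv'_translateSum {d : ℕ} (S : Finset (Fin d → ℝ)) (c a : ℝ)
    {g : (Fin d → ℝ) → ℝ} (hg : IsSmoothBump g) (i : Fin d) (n : ℕ) :
    (pderiv' i)^[n] (translateSum S c a g) = translateSum S c (a * c ^ n) ((pderiv' i)^[n] g) := by
  induction n with
  | zero => simp
  | succ n ih =>
    rw [Function.iterate_succ_apply', ih, Function.iterate_succ_apply',
      pderiv'_translateSum S c _ ((hg.iterate_pderiv' i n).1.differentiable (by simp)),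
      pow_succ, mul_assoc]

theorem mpderiv_translateSum {d : ℕ} (S : Finset (Fin d → ℝ)) (c a : ℝ)
    {g : (Fin d → ℝ) → ℝ} (hg : IsSmoothBump g) (s : Fin d → ℕ) :
    mpderiv s (translateSum S c a g) = translateSum S c (a * c ^ ∑ i, s i) (mpderiv s g) := by
  have key : ∀ l : List (Fin d),
      l.foldr (fun i g => (pderiv' i)^[s i] g) (translateSum S c a g) =
        translateSum S c (a * c ^ (l.map s).sum)
          (l.foldr (fun i g => (pderiv' i)^[s i] g) g) := by
    intro l
    induction l with
    | nil => simp
    | cons i l ih =>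
      rw [List.foldr_cons, ih, iterate_pderiv'_translateSum S c _ (hg.foldr_pderiv' s l),
        List.foldr_cons, List.map_cons, List.sum_cons, mul_assoc, ← pow_add, add_comm (s i)]
  have h := key (List.finRange d)
  rwa [← List.ofFn_eq_map, List.sum_ofFn] at h

theorem contDiff_translateSum {d : ℕ} (S : Finset (Fin d → ℝ)) (c a : ℝ)
    {g : (Fin d → ℝ) → ℝ} (hg : IsSmoothBump g) (n : ℕ) :
    ContDiff ℝ n (translateSum S c a g) := by
  unfold translateSum
  have h : ContDiff ℝ n g := hg.1.of_le (by exact_mod_cast le_top)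
  refine ContDiff.sum fun ξ _ => contDiff_const.mul (h.comp ?_)
  fun_prop

/-! ### Bounds for superpositions over separated sets -/

/-- In a `σ`-separated set, at most one point is within distance `< σ / 2` of a given point. -/
theorem card_filter_dist_lt_le_one {X : Type*} [PseudoMetricSpace X] {S : Finset X} {σ : ℝ}
    (hS : ∀ ξ ∈ S, ∀ η ∈ S, ξ ≠ η → σ ≤ dist ξ η) (x : X) :
    (S.filter fun ξ => dist x ξ < σ / 2).card ≤ 1 := by
  refine Finset.card_le_one.2 fun ξ hξ η hη => ?_
  rw [Finset.mem_filter] at hξ hη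
  by_contra h
  linarith [hS ξ hξ.1 η hη.1 h, dist_triangle_left ξ η x, hξ.2, hη.2]

theorem IsSmoothBump.scaled_eq_zero {d : ℕ} {g : (Fin d → ℝ) → ℝ} (hg : IsSmoothBump g)
    {σ : ℝ} (hσ : 0 < σ) {x ξ : Fin d → ℝ} (h : σ / 2 ≤ dist x ξ) :
    g (σ⁻¹ • (x - ξ)) = 0 := by
  apply hg.eq_zero
  rw [norm_smul, ← dist_eq_norm, Real.norm_of_nonneg (by positivity), inv_mul_eq_div,
    le_div_iff₀ hσ]
  linarith

theorem abs_translateSum_le {d : ℕ} {S : Finset (Fin d → ℝ)} {σ a K : ℝ} (hσ : 0 < σ)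
    (hS : ∀ ξ ∈ S, ∀ η ∈ S, ξ ≠ η → σ ≤ dist ξ η) {g : (Fin d → ℝ) → ℝ}
    (hg : IsSmoothBump g) (ha : 0 ≤ a) (hb : ∀ x, |g x| ≤ K) (x : Fin d → ℝ) :
    |translateSum S σ⁻¹ a g x| ≤ a * K := by
  have hK : 0 ≤ K := (abs_nonneg _).trans (hb x)
  rw [translateSum, ← Finset.sum_subset (Finset.filter_subset (fun ξ => dist x ξ < σ / 2) S)
    fun ξ hξ h => by
      rw [hg.scaled_eq_zero hσ (not_lt.1 fun h' => h (Finset.mem_filter.2 ⟨hξ, h'⟩)), mul_zero]]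
  calc _ ≤ ∑ ξ ∈ S.filter (fun ξ => dist x ξ < σ / 2), |a * g (σ⁻¹ • (x - ξ))| :=
        Finset.abs_sum_le_sum_abs _ _
    _ ≤ (S.filter (fun ξ => dist x ξ < σ / 2)).card • (a * K) :=
        Finset.sum_le_card_nsmul _ _ _ fun ξ _ => by
          rw [abs_mul, abs_of_nonneg ha]; exact mul_le_mul_of_nonneg_left (hb _) ha
    _ ≤ 1 • (a * K) := nsmul_le_nsmul_left (by positivity) (card_filter_dist_lt_le_one hS x)
    _ = a * K := one_nsmul _

theorem abs_translateSum_sub_le {d : ℕ} {S : Finset (Fin d → ℝ)} {σ a K γ : ℝ} (hσ : 0 < σ)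
    (hS : ∀ ξ ∈ S, ∀ η ∈ S, ξ ≠ η → σ ≤ dist ξ η) {g : (Fin d → ℝ) → ℝ}
    (hg : IsSmoothBump g) (ha : 0 ≤ a) (hb : ∀ x y, |g x - g y| ≤ K * dist x y ^ γ)
    (hK : 0 ≤ K) (x y : Fin d → ℝ) :
    |translateSum S σ⁻¹ a g x - translateSum S σ⁻¹ a g y| ≤
      2 * (a * (K * (dist x y / σ) ^ γ)) := by
  classical
  set T := S.filter (fun ξ => dist x ξ < σ / 2) ∪ S.filter (fun ξ => dist y ξ < σ / 2) with hT
  have hcard : T.card ≤ 2 := (Finset.card_union_le _ _).trans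
    (add_le_add (card_filter_dist_lt_le_one hS x) (card_filter_dist_lt_le_one hS y))
  have hTS : T ⊆ S := Finset.union_subset (Finset.filter_subset _ _) (Finset.filter_subset _ _)
  have hd : ∀ ξ, dist (σ⁻¹ • (x - ξ)) (σ⁻¹ • (y - ξ)) = dist x y / σ := fun ξ => by
    rw [dist_smul₀, dist_sub_right, Real.norm_of_nonneg (by positivity), inv_mul_eq_div]
  rw [translateSum, translateSum, ← Finset.sum_sub_distrib, ← Finset.sum_subset hTS
    fun ξ hξ h => by
      simp only [hT, Finset.mem_union, Finset.mem_filter, hξ, true_and, not_or, not_lt] at h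
      rw [hg.scaled_eq_zero hσ h.1, hg.scaled_eq_zero hσ h.2, sub_self]]
  calc _ ≤ ∑ ξ ∈ T, |a * g (σ⁻¹ • (x - ξ)) - a * g (σ⁻¹ • (y - ξ))| :=
        Finset.abs_sum_le_sum_abs _ _
    _ ≤ T.card • (a * (K * (dist x y / σ) ^ γ)) :=
        Finset.sum_le_card_nsmul _ _ _ fun ξ _ => by
          rw [← mul_sub, abs_mul, abs_of_nonneg ha, ← hd ξ]
          exact mul_le_mul_of_nonneg_left (hb _ _) ha
    _ ≤ 2 • (a * (K * (dist x y / σ) ^ γ)) := nsmul_le_nsmul_left (by positivity) hcard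
    _ = _ := by rw [nsmul_eq_mul]; norm_num

theorem finite_multiindex_le (d n : ℕ) : Finite {s : Fin d → ℕ // ∑ i, s i ≤ n} :=
  ((Set.finite_Iic fun _ : Fin d => n).subset fun _ hs i =>
    (Finset.single_le_sum (fun _ _ => Nat.zero_le _) (Finset.mem_univ i)).trans hs).to_subtype

theorem finite_multiindex_eq (d n : ℕ) : Finite {s : Fin d → ℕ // ∑ i, s i = n} :=
  ((Set.finite_Iic fun _ : Fin d => n).subset fun s (hs : ∑ i, s i = n) i =>
    (Finset.single_le_sum (fun _ _ => Nat.zero_le _) (Finset.mem_univ i)).trans hs.le).to_subtype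

theorem ENNReal.tsum_le_natCard_mul {ι : Type*} [Finite ι] {f : ι → ℝ≥0∞} {b : ℝ≥0∞}
    (h : ∀ i, f i ≤ b) : ∑' i, f i ≤ Nat.card ι * b := by
  have := Fintype.ofFinite ι
  rw [tsum_fintype, Nat.card_eq_fintype_card, ← nsmul_eq_mul]
  exact Finset.sum_le_card_nsmul _ _ _ fun i _ => h i

theorem enorm_le_ofReal_of_abs_le {r b : ℝ} (h : |r| ≤ b) : (‖r‖₊ : ℝ≥0∞) ≤ ENNReal.ofReal b := by
  rw [← enorm_eq_nnnorm, Real.enorm_eq_ofReal_abs]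
  exact ENNReal.ofReal_le_ofReal h

/-- Uniformly over `σ`-separated sets `S`, `σ ≤ 1`, the functions
`x ↦ κ σ ^ β ∑ ξ ∈ S, g ((x - ξ) / σ)` lie in a fixed Hölder ball. -/
theorem exists_translateSum_mem_holderClass {d : ℕ} {β C : ℝ} (hβ : 0 < β) (hC : 0 < C)
    {g : (Fin d → ℝ) → ℝ} (hg : IsSmoothBump g) :
    ∃ κ > (0 : ℝ), ∀ (S : Finset (Fin d → ℝ)) (σ : ℝ), 0 < σ → σ ≤ 1 →
      (∀ ξ ∈ S, ∀ η ∈ S, ξ ≠ η → σ ≤ dist ξ η) →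
        translateSum S σ⁻¹ (κ * σ ^ β) g ∈ HolderClass d β C := by
  set k := ⌊β⌋₊
  have := finite_multiindex_le d k
  have := finite_multiindex_eq d k
  have hkβ : (k : ℝ) ≤ β := Nat.floor_le hβ.le
  have hβk : β < k + 1 := Nat.lt_floor_add_one β
  obtain ⟨K, hK0, hK⟩ : ∃ K : ℝ, 0 < K ∧ ∀ s : Fin d → ℕ, ∑ i, s i ≤ k →
      (∀ x, |mpderiv s g x| ≤ K) ∧ ∀ x y, |mpderiv s g x - mpderiv s g y| ≤ K * dist x y := by
    choose B hB using fun s => (hg.mpderiv s).exists_bound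
    obtain ⟨M, hM⟩ := (Set.finite_range
      fun s : {s : Fin d → ℕ // ∑ i, s i ≤ k} => B s.1).bddAbove
    refine ⟨max M 1, by positivity, fun s hs => ?_⟩
    have hle : B s ≤ max M 1 := (hM ⟨⟨s, hs⟩, rfl⟩).trans (le_max_left _ _)
    exact ⟨fun x => ((hB s).1 x).trans hle,
      fun x y => ((hB s).2 x y).trans (mul_le_mul_of_nonneg_right hle dist_nonneg)⟩
  set N₁ := Nat.card {s : Fin d → ℕ // ∑ i, s i ≤ k}
  set N₂ := Nat.card {s : Fin d → ℕ // ∑ i, s i = k}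
  set D : ℝ := (N₁ + 4 * N₂ + 1) * K with hD
  have hD0 : 0 < D := by positivity
  refine ⟨C / D, by positivity, fun S σ hσ hσ1 hS => ⟨contDiff_translateSum _ _ _ hg _, ?_⟩⟩
  set κ := C / D with hκ
  have hκ0 : 0 < κ := by positivity
  have hcoef : ∀ n : ℕ, κ * σ ^ β * σ⁻¹ ^ n = κ * σ ^ (β - n) := fun n => by
    rw [Real.rpow_sub hσ, Real.rpow_natCast, inv_pow, mul_assoc, div_eq_mul_inv]
  have h1 : ∀ s : {s : Fin d → ℕ // ∑ i, s i ≤ k},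
      (⨆ x, (‖mpderiv s.1 (translateSum S σ⁻¹ (κ * σ ^ β) g) x‖₊ : ℝ≥0∞)) ≤
        ENNReal.ofReal (κ * K) := by
    rintro ⟨s, hs⟩
    refine iSup_le fun x => enorm_le_ofReal_of_abs_le ?_
    rw [mpderiv_translateSum S _ _ hg, hcoef]
    refine (abs_translateSum_le hσ hS (hg.mpderiv s) (by positivity) (hK s hs).1 x).trans ?_
    have hsβ : ((∑ i, s i : ℕ) : ℝ) ≤ β := (Nat.cast_le.2 hs).trans hkβ
    have : σ ^ (β - (∑ i, s i : ℕ)) ≤ 1 := Real.rpow_le_one hσ.le hσ1 (sub_nonneg.2 hsβ)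
    exact mul_le_mul_of_nonneg_right (mul_le_of_le_one_right hκ0.le this) hK0.le
  have h2 : ∀ s : {s : Fin d → ℕ // ∑ i, s i = k},
      (⨆ (x : Fin d → ℝ) (y : Fin d → ℝ) (_ : x ≠ y),
        (‖mpderiv s.1 (translateSum S σ⁻¹ (κ * σ ^ β) g) x -
          mpderiv s.1 (translateSum S σ⁻¹ (κ * σ ^ β) g) y‖₊ : ℝ≥0∞) /
            (nndist x y : ℝ≥0∞) ^ (β - (k : ℝ))) ≤ ENNReal.ofReal (4 * (κ * K)) := by
    rintro ⟨s, hs⟩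
    refine iSup_le fun x => iSup_le fun y => iSup_le fun hxy => ?_
    have hpos : 0 < dist x y := dist_pos.2 hxy
    have hden : (nndist x y : ℝ≥0∞) ^ (β - (k : ℝ)) = ENNReal.ofReal (dist x y ^ (β - (k : ℝ))) := by
      rw [← edist_nndist, edist_dist, ENNReal.ofReal_rpow_of_pos hpos]
    rw [hden]
    refine ENNReal.div_le_of_le_mul ?_
    rw [← ENNReal.ofReal_mul (by positivity)]
    refine enorm_le_ofReal_of_abs_le ?_
    rw [mpderiv_translateSum S _ _ hg, hcoef, hs]
    refine (abs_translateSum_sub_le hσ hS (hg.mpderiv s) (by positivity)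
      (abs_sub_le_rpow_dist (hK s hs.le).1 (hK s hs.le).2 (sub_nonneg.2 hkβ) (by linarith))
      (by positivity) x y).trans (le_of_eq ?_)
    rw [Real.div_rpow hpos.le hσ.le]
    have : σ ^ (β - (k : ℝ)) ≠ 0 := by positivity
    field_simp
    ring
  calc holderNorm β (translateSum S σ⁻¹ (κ * σ ^ β) g)
      ≤ N₁ * ENNReal.ofReal (κ * K) + N₂ * ENNReal.ofReal (4 * (κ * K)) :=
        add_le_add (ENNReal.tsum_le_natCard_mul h1) (ENNReal.tsum_le_natCard_mul h2)
    _ = ENNReal.ofReal (N₁ * (κ * K) + N₂ * (4 * (κ * K))) := by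
        rw [ENNReal.ofReal_add (by positivity) (by positivity), ENNReal.ofReal_mul (p := (N₁ : ℝ)) (by positivity),
          ENNReal.ofReal_mul (p := (N₂ : ℝ)) (by positivity), ENNReal.ofReal_natCast,
          ENNReal.ofReal_natCast]
    _ ≤ ENNReal.ofReal C := by
        refine ENNReal.ofReal_le_ofReal ?_
        have : κ * D = C := div_mul_cancel₀ _ hD0.ne'
        have : 0 ≤ κ * K := by positivity
        nlinarith

/-! ### The lower bound -/

theorem exists_isSmoothBump (d : ℕ) : ∃ g : (Fin d → ℝ) → ℝ, IsSmoothBump g ∧ g 0 = 1 := by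
  let b : ContDiffBump (0 : Fin d → ℝ) := ⟨1 / 8, 1 / 4, by norm_num, by norm_num⟩
  exact ⟨b, ⟨b.contDiff, b.tsupport_eq.subset⟩, b.one_of_mem_closedBall (by simp [b])⟩

theorem mpderiv_zero {d : ℕ} (f : (Fin d → ℝ) → ℝ) : mpderiv 0 f = f := by
  simp [mpderiv]

theorem abs_le_of_mem_holderClass {d : ℕ} {β C : ℝ} (hC : 0 < C) {f : (Fin d → ℝ) → ℝ}
    (hf : f ∈ HolderClass d β C) (x : Fin d → ℝ) : |f x| ≤ C := by
  have h1 : (‖f x‖₊ : ℝ≥0∞) ≤ ENNReal.ofReal C := by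
    refine le_trans ?_ hf.2
    refine le_trans ?_ le_self_add
    refine le_trans ?_ (ENNReal.le_tsum ⟨0, by simp⟩)
    simp only [mpderiv_zero]
    exact le_iSup (fun x => (‖f x‖₊ : ℝ≥0∞)) x
  rw [← enorm_eq_nnnorm, Real.enorm_eq_ofReal_abs] at h1
  exact (ENNReal.ofReal_le_ofReal_iff hC.le).1 h1

theorem bddAbove_range_ipm_holderClass {d : ℕ} {β C : ℝ} (hC : 0 < C)
    (P Q : Measure (Fin d → ℝ)) [IsProbabilityMeasure P] [IsProbabilityMeasure Q] :
    BddAbove (Set.range fun f : HolderClass d β C => |∫ x, f.1 x ∂P - ∫ x, f.1 x ∂Q|) := by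
  refine ⟨C + C, ?_⟩
  rintro _ ⟨f, rfl⟩
  have key : ∀ (μ : Measure (Fin d → ℝ)) [IsProbabilityMeasure μ], |∫ x, f.1 x ∂μ| ≤ C := by
    intro μ _
    simpa using norm_integral_le_of_norm_le_const (μ := μ) (f := f.1) (C := C)
      (Eventually.of_forall fun x => abs_le_of_mem_holderClass hC f.2 x)
  exact (abs_sub _ _).trans (add_le_add (key P) (key Q))

theorem finsep_le_dist {d : ℕ} {Ξ : Finset (Fin d → ℝ)} {ξ η : Fin d → ℝ} (hξ : ξ ∈ Ξ)
    (hη : η ∈ Ξ) (h : ξ ≠ η) : finsep Ξ ≤ dist ξ η :=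
  ciInf_le (f := fun p : {p : (Fin d → ℝ) × (Fin d → ℝ) // p.1 ∈ Ξ ∧ p.2 ∈ Ξ ∧ p.1 ≠ p.2} =>
    dist p.1.1 p.1.2) ⟨0, by rintro _ ⟨p, rfl⟩; exact dist_nonneg⟩ ⟨(ξ, η), hξ, hη, h⟩

theorem finsep_pos {d : ℕ} {Ξ : Finset (Fin d → ℝ)} (hΞ : 2 ≤ Ξ.card) : 0 < finsep Ξ := by
  obtain ⟨ξ, hξ, η, hη, h⟩ := Finset.one_lt_card.1 hΞ
  have : Finite {p : (Fin d → ℝ) × (Fin d → ℝ) // p.1 ∈ Ξ ∧ p.2 ∈ Ξ ∧ p.1 ≠ p.2} :=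
    ((Ξ ×ˢ Ξ).finite_toSet.subset fun p hp => by
      simpa using (⟨hp.1, hp.2.1⟩ : p.1 ∈ Ξ ∧ p.2 ∈ Ξ)).to_subtype
  have : Nonempty {p : (Fin d → ℝ) × (Fin d → ℝ) // p.1 ∈ Ξ ∧ p.2 ∈ Ξ ∧ p.1 ≠ p.2} :=
    ⟨⟨(ξ, η), hξ, hη, h⟩⟩
  obtain ⟨p, hp⟩ := exists_eq_ciInf_of_finite
    (f := fun p : {p : (Fin d → ℝ) × (Fin d → ℝ) // p.1 ∈ Ξ ∧ p.2 ∈ Ξ ∧ p.1 ≠ p.2} =>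
      dist p.1.1 p.1.2)
  rw [finsep, ← hp]
  exact dist_pos.2 p.2.2.2

theorem finsep_le_one {d : ℕ} {Ξ : Finset (Fin d → ℝ)} (hΞ : 2 ≤ Ξ.card)
    (hI : (Ξ : Set (Fin d → ℝ)) ⊆ Set.Icc 0 1) : finsep Ξ ≤ 1 := by
  obtain ⟨ξ, hξ, η, hη, h⟩ := Finset.one_lt_card.1 hΞ
  refine (finsep_le_dist hξ hη h).trans ((dist_pi_le_iff zero_le_one).2 fun i => ?_)
  have := Real.dist_le_of_mem_Icc ⟨(hI hξ).1 i, (hI hξ).2 i⟩ ⟨(hI hη).1 i, (hI hη).2 i⟩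
  simpa using this

theorem translateSum_filter_apply {d : ℕ} {Ξ : Finset (Fin d → ℝ)} {σ a : ℝ} (hσ : 0 < σ)
    (hΞ : ∀ ξ ∈ Ξ, ∀ η ∈ Ξ, ξ ≠ η → σ ≤ dist ξ η) {g : (Fin d → ℝ) → ℝ}
    (hg : IsSmoothBump g) (hg0 : g 0 = 1) (A : Set (Fin d → ℝ)) [DecidablePred (· ∈ A)]
    {x : Fin d → ℝ} (hx : x ∈ Ξ) :
    translateSum (Ξ.filter (· ∈ A)) σ⁻¹ a g x = A.indicator (fun _ => a) x := by
  have h0 : ∀ ξ ∈ Ξ, ξ ≠ x → a * g (σ⁻¹ • (x - ξ)) = 0 := fun ξ hξ h => by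
    rw [hg.scaled_eq_zero hσ (by linarith [hΞ x hx ξ hξ h.symm]), mul_zero]
  unfold translateSum
  by_cases hA : x ∈ A
  · rw [Finset.sum_eq_single x (fun ξ hξ h => h0 ξ (Finset.mem_filter.1 hξ).1 h)
      (fun h => absurd (Finset.mem_filter.2 ⟨hx, hA⟩) h)]
    simp [hA, hg0]
  · rw [Set.indicator_of_notMem hA]
    refine Finset.sum_eq_zero fun ξ hξ => ?_
    rw [Finset.mem_filter] at hξ
    exact h0 ξ hξ.1 fun h => hA (h ▸ hξ.2)

theorem integral_eq_of_eqOn_indicator {d : ℕ} {Ξ : Finset (Fin d → ℝ)}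
    {μ : Measure (Fin d → ℝ)} [IsProbabilityMeasure μ] (hμ : μ ↑Ξ = 1) {f : (Fin d → ℝ) → ℝ}
    {A : Set (Fin d → ℝ)} (hA : MeasurableSet A) {a : ℝ}
    (hf : ∀ x ∈ Ξ, f x = A.indicator (fun _ => a) x) : ∫ x, f x ∂μ = a * (μ A).toReal := by
  have hae : ∀ᵐ x ∂μ, x ∈ (Ξ : Set (Fin d → ℝ)) :=
    (prob_compl_eq_zero_iff Ξ.measurableSet).2 hμ
  rw [integral_congr_ae (hae.mono fun x hx => hf x hx), integral_indicator_const _ hA,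
    smul_eq_mul, mul_comm, Measure.real]

/-- There is a constant `c > 0`, depending only on `d`, `β` and `C`, such
that for every finite set `Ξ ⊆ [0,1]^d` with at least two points and all Borel probability
measures `P, Q` supported on `Ξ`,
`‖P − Q‖_{H^β(ℝ^d,ℝ,C)} ≥ c ⋅ sep(Ξ)^β ⋅ ‖P − Q‖_TV`. -/
theorem holder_ipm_lower_bound_tv
    (d : ℕ) (β C : ℝ) (hβ : 0 < β) (hC : 0 < C) :
    ∃ c > (0 : ℝ), ∀ Ξ : Finset (Fin d → ℝ), ↑Ξ ⊆ Set.Icc (0 : Fin d → ℝ) 1 → 2 ≤ Ξ.card →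
      ∀ P Q : Measure (Fin d → ℝ), IsProbabilityMeasure P → IsProbabilityMeasure Q →
        P ↑Ξ = 1 → Q ↑Ξ = 1 →
        c * finsep Ξ ^ β * tvDist P Q ≤ ipm (HolderClass d β C) P Q := by
  classical
  obtain ⟨g, hg, hg0⟩ := exists_isSmoothBump d
  obtain ⟨κ, hκ, hmem⟩ := exists_translateSum_mem_holderClass hβ hC hg
  refine ⟨κ, hκ, fun Ξ hI hΞ P Q _ _ hP hQ => ?_⟩
  have hσ := finsep_pos hΞ
  have hsep : ∀ ξ ∈ Ξ, ∀ η ∈ Ξ, ξ ≠ η → finsep Ξ ≤ dist ξ η :=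
    fun ξ hξ η hη h => finsep_le_dist hξ hη h
  have ha : 0 < κ * finsep Ξ ^ β := by positivity
  rw [mul_comm, ← le_div_iff₀ ha]
  have : Nonempty {A : Set (Fin d → ℝ) // MeasurableSet A} := ⟨⟨∅, MeasurableSet.empty⟩⟩
  refine ciSup_le fun A => ?_
  rw [le_div_iff₀ ha]
  have hf := hmem (Ξ.filter (· ∈ A.1)) (finsep Ξ) hσ (finsep_le_one hΞ hI) fun ξ hξ η hη =>
    hsep ξ (Finset.mem_filter.1 hξ).1 η (Finset.mem_filter.1 hη).1
  refine le_trans (le_of_eq ?_) (le_ciSup (bddAbove_range_ipm_holderClass hC P Q) ⟨_, hf⟩)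
  have hind := fun x (hx : x ∈ Ξ) =>
    translateSum_filter_apply (a := κ * finsep Ξ ^ β) hσ hsep hg hg0 A.1 hx
  simp only [integral_eq_of_eqOn_indicator hP A.2 hind, integral_eq_of_eqOn_indicator hQ A.2 hind]
  rw [← mul_sub, abs_mul, abs_of_pos ha, mul_comm]
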